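/- Assume (A1), (A2) with (A4), and (A±). Let γ₊, γ₋ : (0,∞) → (0,∞) be continuous increasing functions with γ₊(t) → ∞ and γ₋(t) → ∞, such that limsup_{t→∞} |H(t)|/γ₊(t) = 0 and limsup_{t→∞} |H(t)|/γ₋(t) = ∞ (hypothesis (F2)). If γ₊(t)/(M ∫₀ᵗ f(γ₊(s)) ds) → ∞ and γ₋(t)/(M ∫₀ᵗ f(γ₋(s)) ds) → ∞ as t → ∞, then |x(t)|/γ₊(t) → 0 as t → ∞ and limsup_{t→∞} |x(t)|/γ₋(t) = ∞. -/

import Mathlib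

open Filter MeasureTheory

lemma aux_phi {φ φd : ℝ → ℝ} (hφ_deriv : ∀ y ≥ (0:ℝ), HasDerivAt φ (φd y) y)
    (hφ_pos : ∀ y ≥ (0:ℝ), 0 < φ y)
    (hφd_pos : ∀ y ≥ (0:ℝ), 0 < φd y)
    (hφd_anti : AntitoneOn φd (Set.Ici 0)) :
    ContinuousOn φ (Set.Ici 0) ∧ MonotoneOn φ (Set.Ici 0) ∧
      ∀ K ≥ (1:ℝ), ∀ y ≥ (0:ℝ), φ (K * y) ≤ K * φ y := by
  have hc : ContinuousOn φ (Set.Ici 0) := fun y hy =>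
    (hφ_deriv y hy).continuousAt.continuousWithinAt
  refine ⟨hc, ?_, ?_⟩
  · apply monotoneOn_of_deriv_nonneg (convex_Ici 0) hc
    · intro y hy
      rw [interior_Ici] at hy
      exact (hφ_deriv y (le_of_lt hy)).differentiableAt.differentiableWithinAt
    · intro y hy
      rw [interior_Ici] at hy
      rw [(hφ_deriv y (le_of_lt hy)).deriv]
      exact (hφd_pos y (le_of_lt hy)).le
  · intro K hK y hy
    have hd : ∀ z ≥ (0:ℝ), HasDerivAt (fun z => K * φ z - φ (K * z)) (K * φd z - φd (K * z) * K) z := by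
      intro z hz
      have h1 := (hφ_deriv z hz).const_mul K
      have hz' : K * z ≥ 0 := by positivity
      have h2 : HasDerivAt (fun z => K * z) K z := by
        simpa using (hasDerivAt_id z).const_mul K
      exact h1.sub ((hφ_deriv (K * z) hz').comp z h2)
    have hm : MonotoneOn (fun z => K * φ z - φ (K * z)) (Set.Ici 0) := by
      apply monotoneOn_of_deriv_nonneg (convex_Ici 0)
      · exact fun z hz => (hd z hz).continuousAt.continuousWithinAt
      · intro z hz
        rw [interior_Ici] at hz
        exact (hd z (le_of_lt hz)).differentiableAt.differentiableWithinAt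
      · intro z hz
        rw [interior_Ici] at hz
        have hz0 : (0:ℝ) < z := hz
        rw [(hd z (le_of_lt hz)).deriv]
        have : φd (K * z) ≤ φd z := hφd_anti hz0.le (show (0:ℝ) ≤ K * z by positivity)
          (by nlinarith)
        nlinarith
    have h0 := hm (Set.self_mem_Ici (a := (0:ℝ))) hy hy
    simp only [mul_zero] at h0
    have := hφ_pos 0 le_rfl
    nlinarith

lemma aux_bound {f φ : ℝ → ℝ} (hf : Continuous f) (hc : ContinuousOn φ (Set.Ici 0))
    (hφ_pos : ∀ y ≥ (0:ℝ), 0 < φ y)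
    (hfφ : Tendsto (fun y => |f y| / φ |y|) (Filter.cocompact ℝ) (nhds 1)) :
    ∃ C > (0:ℝ), ∀ y, |f y| ≤ C * φ |y| := by
  have h2 : ∀ᶠ y in Filter.cocompact ℝ, |f y| / φ |y| < 2 :=
    hfφ.eventually (gt_mem_nhds (by norm_num))
  obtain ⟨S, hS, hS2⟩ := Filter.mem_cocompact.1 h2
  have hcont : Continuous (fun y => |f y| / φ |y|) := by
    apply hf.abs.div
    · exact hc.comp_continuous continuous_abs (fun y => abs_nonneg y)
    · exact fun y => (hφ_pos _ (abs_nonneg y)).ne'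
  obtain ⟨B, hB⟩ := hS.bddAbove_image hcont.continuousOn
  refine ⟨max 2 B, by positivity, fun y => ?_⟩
  rw [← div_le_iff₀ (hφ_pos _ (abs_nonneg y))]
  by_cases hy : y ∈ S
  · exact le_max_of_le_right (hB ⟨y, hy, rfl⟩)
  · exact le_max_of_le_left (le_of_lt (hS2 hy))

lemma aux_gamma {f φ γ : ℝ → ℝ} {M : ℝ} (hM : 0 < M) (hf : Continuous f)
    (hc : ContinuousOn φ (Set.Ici 0)) (hmono : MonotoneOn φ (Set.Ici 0))
    (hφ_pos : ∀ y ≥ (0:ℝ), 0 < φ y)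
    (hfφ : Tendsto (fun y => |f y| / φ |y|) (Filter.cocompact ℝ) (nhds 1))
    (hγ_cont : ContinuousOn γ (Set.Ioi 0)) (hγ_pos : ∀ t > (0:ℝ), 0 < γ t)
    (hγ_inf : Tendsto γ atTop atTop)
    (hL : Tendsto (fun t => γ t / (M * ∫ s in (0:ℝ)..t, f (γ s))) atTop atTop) :
    ∃ T0 > (0:ℝ), Tendsto (fun t => (∫ s in T0..t, φ (γ s)) / γ t) atTop (nhds 0) := by
  -- lower bound on |f|
  have h1 : ∀ᶠ y in atTop, (1/2:ℝ) < |f y| / φ |y| :=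
    (hfφ.mono_left atTop_le_cocompact).eventually (lt_mem_nhds (by norm_num))
  obtain ⟨Y, hY⟩ := eventually_atTop.1 h1
  set Z := max Y 0 with hZ
  have hlow : ∀ y ≥ Z, φ y ≤ 2 * |f y| := by
    intro y hy
    have hy0 : 0 ≤ y := le_trans (le_max_right _ _) hy
    have := hY y (le_trans (le_max_left _ _) hy)
    rw [abs_of_nonneg hy0, lt_div_iff₀ (hφ_pos y hy0)] at this
    linarith
  have hne : ∀ y ≥ Z, f y ≠ 0 := by
    intro y hy h
    have h8 := hlow y hy
    have h9 := hφ_pos y (le_trans (le_max_right _ _) hy)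
    rw [h, abs_zero] at h8
    linarith
  have hsign : (∀ y ≥ Z, 0 < f y) ∨ (∀ y ≥ Z, f y < 0) := by
    by_contra hcon
    push Not at hcon
    obtain ⟨⟨a, ha, hfa⟩, b, hb, hfb⟩ := hcon
    have := isPreconnected_Ici.intermediate_value (s := Set.Ici Z) ha hb hf.continuousOn
    obtain ⟨y, hy, hy0⟩ := this ⟨hfa, hfb⟩
    exact hne y hy hy0
  obtain ⟨T1, hT1⟩ := eventually_atTop.1 (hγ_inf.eventually_ge_atTop Z)
  set T0 := max T1 1 with hT0
  have hT0pos : 0 < T0 := by positivity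
  have hg : ∀ t ≥ T0, Z ≤ γ t := fun t ht => hT1 t (le_trans (le_max_left _ _) ht)
  -- positivity of the integral
  have hpos : ∀ᶠ t in atTop, 0 < ∫ s in (0:ℝ)..t, f (γ s) := by
    filter_upwards [hL.eventually_gt_atTop 0, eventually_gt_atTop 0] with t ht ht0
    have h3 : 0 < M * ∫ s in (0:ℝ)..t, f (γ s) := by
      by_contra hcon
      push Not at hcon
      have := div_nonpos_of_nonneg_of_nonpos (hγ_pos t ht0).le hcon
      linarith
    exact pos_of_mul_pos_right h3 hM.le
  have hcontfγ : ContinuousOn (fun s => f (γ s)) (Set.Ioi 0) := hf.comp_continuousOn hγ_cont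
  have hcontφγ : ContinuousOn (fun s => φ (γ s)) (Set.Ioi 0) :=
    hc.comp hγ_cont (fun s hs => (hγ_pos s hs).le)
  have hint : ∀ {g : ℝ → ℝ}, ContinuousOn g (Set.Ioi 0) → ∀ t ≥ T0,
      IntervalIntegrable g volume T0 t := by
    intro g hg t ht
    apply ContinuousOn.intervalIntegrable
    rw [Set.uIcc_of_le ht]
    exact hg.mono (fun s hs => lt_of_lt_of_le hT0pos hs.1)
  set c := ∫ s in (0:ℝ)..T0, f (γ s) with hcdef
  have hsplit : ∀ᶠ t in atTop, ∫ s in (0:ℝ)..t, f (γ s) = c + ∫ s in T0..t, f (γ s) := by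
    filter_upwards [hpos, eventually_ge_atTop T0] with t ht htT
    have hi : IntervalIntegrable (fun s => f (γ s)) volume 0 t := by
      by_contra hcon
      rw [intervalIntegral.integral_undef hcon] at ht
      exact lt_irrefl _ ht
    rw [hcdef, intervalIntegral.integral_add_adjacent_intervals _ (hint hcontfγ t htT)]
    apply hi.mono_set
    rw [Set.uIcc_of_le hT0pos.le, Set.uIcc_of_le (hT0pos.le.trans htT)]
    exact Set.Icc_subset_Icc_right htT
  have hfpos : ∀ y ≥ Z, 0 < f y := by
    rcases hsign with h | h
    · exact h
    exfalso
    have hb : ∀ t ≥ T0, ∫ s in T0..t, f (γ s) ≤ (t - T0) * (-(φ 0 / 2)) := by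
      intro t ht
      have : ∫ s in T0..t, f (γ s) ≤ ∫ s in T0..t, (-(φ 0 / 2)) := by
        apply intervalIntegral.integral_mono_on ht (hint hcontfγ t ht) (by simp)
        intro s hs
        have hZs := hg s hs.1
        have h4 := hlow _ hZs
        rw [abs_of_neg (h _ hZs)] at h4
        have h0 : 0 ≤ γ s := (hγ_pos s (lt_of_lt_of_le hT0pos hs.1)).le
        have h5 := hmono Set.self_mem_Ici h0 h0
        linarith
      rwa [intervalIntegral.integral_const, smul_eq_mul] at this
    have hφ0 := hφ_pos 0 le_rfl
    obtain ⟨t, ht1, ht2, ht3, ht4⟩ := (hpos.and (hsplit.and ((eventually_ge_atTop T0).and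
      (eventually_gt_atTop (T0 + |c| / (φ 0 / 2))))) ).exists
    have h6 := hb t ht3
    rw [ht2] at ht1
    have h7 : |c| / (φ 0 / 2) < t - T0 := by linarith
    rw [div_lt_iff₀ (by positivity)] at h7
    have := le_abs_self c
    linarith
  refine ⟨T0, hT0pos, ?_⟩
  have hI : Tendsto (fun t => (∫ s in (0:ℝ)..t, f (γ s)) / γ t) atTop (nhds 0) := by
    have := (hL.inv_tendsto_atTop).const_mul (M⁻¹)
    rw [mul_zero] at this
    refine this.congr (fun t => ?_)
    simp only [Pi.inv_apply, inv_div]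
    field_simp
  have hC : Tendsto (fun t => c / γ t) atTop (nhds 0) := hγ_inf.const_div_atTop c
  have hU := (hI.sub hC).const_mul 2
  rw [sub_zero, mul_zero] at hU
  refine tendsto_of_tendsto_of_tendsto_of_le_of_le' tendsto_const_nhds hU ?_ ?_
  · filter_upwards [eventually_ge_atTop T0] with t ht
    apply div_nonneg _ (hγ_pos t (lt_of_lt_of_le hT0pos ht)).le
    apply intervalIntegral.integral_nonneg ht
    intro s hs
    exact (hφ_pos _ (hγ_pos s (lt_of_lt_of_le hT0pos hs.1)).le).le
  · filter_upwards [eventually_ge_atTop T0, hsplit] with t ht hs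
    rw [hs, ← sub_div, ← mul_div_assoc]
    apply div_le_div_of_nonneg_right _ (hγ_pos t (lt_of_lt_of_le hT0pos ht)).le
    rw [add_sub_cancel_left, ← intervalIntegral.integral_const_mul]
    apply intervalIntegral.integral_mono_on ht (hint hcontφγ t ht) ((hint hcontfγ t ht).const_mul 2)
    intro s hs
    have hZs := hg s hs.1
    have h4 := hlow _ hZs
    rwa [abs_of_pos (hfpos _ hZs)] at h4

lemma aux_vol {μ : Measure ℝ} {M C : ℝ} (hM : 0 < M)
    (hμ : μ Set.univ = ENNReal.ofReal M)
    {f H x φ : ℝ → ℝ} (hx_cont : ContinuousOn x (Set.Ici 0))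
    (heq : ∀ t ≥ (0:ℝ),
      x t = x 0 + (∫ s in (0:ℝ)..t, (μ (Set.Icc 0 (t - s))).toReal * f (x s)) + H t)
    (hc : ContinuousOn φ (Set.Ici 0))
    (hφ_pos : ∀ y ≥ (0:ℝ), 0 < φ y) (hC : 0 < C) (hfC : ∀ y, |f y| ≤ C * φ |y|)
    (T : ℝ) (hT : 0 ≤ T) :
    ∃ A ≥ (0:ℝ), ∀ t ≥ T, |x t - H t| ≤ A + M * C * ∫ s in T..t, φ |x s| := by
  have hcx : ContinuousOn (fun s => φ |x s|) (Set.Ici 0) :=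
    hc.comp hx_cont.abs (fun s _ => abs_nonneg (x s))
  have hint : ∀ a ≥ (0:ℝ), ∀ b ≥ (0:ℝ), IntervalIntegrable (fun s => φ |x s|) volume a b := by
    intro a ha b hb
    apply ContinuousOn.intervalIntegrable
    exact hcx.mono (fun s hs => le_trans (le_min ha hb) hs.1)
  have hnn : 0 ≤ ∫ s in (0:ℝ)..T, φ |x s| :=
    intervalIntegral.integral_nonneg hT (fun s _ => (hφ_pos _ (abs_nonneg _)).le)
  refine ⟨|x 0| + M * C * ∫ s in (0:ℝ)..T, φ |x s|, by positivity, fun t ht => ?_⟩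
  have ht0 : 0 ≤ t := hT.trans ht
  have e : x t - H t = x 0 + ∫ s in (0:ℝ)..t, (μ (Set.Icc 0 (t - s))).toReal * f (x s) := by
    have := heq t ht0
    linarith
  rw [e, add_assoc, ← mul_add, intervalIntegral.integral_add_adjacent_intervals
    (hint 0 le_rfl T hT) (hint T hT t ht0), ← intervalIntegral.integral_const_mul]
  refine (abs_add_le _ _).trans (add_le_add le_rfl ?_)
  rw [← Real.norm_eq_abs]
  apply intervalIntegral.norm_integral_le_of_norm_le ht0 _ ((hint 0 le_rfl t ht0).const_mul _)
  refine Eventually.of_forall (fun s _ => ?_)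
  rw [Real.norm_eq_abs, abs_mul, mul_assoc]
  apply mul_le_mul _ (hfC _) (abs_nonneg _) hM.le
  rw [abs_of_nonneg ENNReal.toReal_nonneg]
  apply ENNReal.toReal_le_of_le_ofReal hM.le
  rw [← hμ]
  exact measure_mono (Set.subset_univ _)

lemma aux_cmp {φ γ x : ℝ → ℝ} (hc : ContinuousOn φ (Set.Ici 0)) (hmono : MonotoneOn φ (Set.Ici 0))
    (hφ_pos : ∀ y ≥ (0:ℝ), 0 < φ y)
    (hK : ∀ K ≥ (1:ℝ), ∀ y ≥ (0:ℝ), φ (K * y) ≤ K * φ y)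
    (hx_cont : ContinuousOn x (Set.Ici 0))
    (hγ_cont : ContinuousOn γ (Set.Ioi 0)) (hγ_pos : ∀ t > (0:ℝ), 0 < γ t)
    {T0 T t K : ℝ} (hT0 : 0 < T0) (hT : T0 ≤ T) (ht : T ≤ t) (hK1 : 1 ≤ K)
    (hb : ∀ s ∈ Set.Icc T t, |x s| ≤ K * γ s) :
    ∫ s in T..t, φ |x s| ≤ K * ∫ s in T0..t, φ (γ s) := by
  have hcx : ContinuousOn (fun s => φ |x s|) (Set.Ici 0) :=
    hc.comp hx_cont.abs (fun s _ => abs_nonneg (x s))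
  have hcg : ContinuousOn (fun s => φ (γ s)) (Set.Ioi 0) :=
    hc.comp hγ_cont (fun s hs => (hγ_pos s hs).le)
  have hint : ∀ a > (0:ℝ), ∀ b > (0:ℝ), IntervalIntegrable (fun s => φ (γ s)) volume a b := by
    intro a ha b hb
    apply ContinuousOn.intervalIntegrable
    exact hcg.mono (fun s hs => lt_of_lt_of_le (lt_min ha hb) hs.1)
  have hTp : 0 < T := by linarith
  have h1 : ∫ s in T..t, φ |x s| ≤ ∫ s in T..t, K * φ (γ s) := by
    apply intervalIntegral.integral_mono_on ht _ ((hint T hTp t (by linarith)).const_mul K)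
    · intro s hs
      have hg := hγ_pos s (lt_of_lt_of_le hTp hs.1)
      exact (hmono (abs_nonneg (x s)) (show (0:ℝ) ≤ K * γ s by positivity) (hb s hs)).trans
        (hK K hK1 _ hg.le)
    · apply ContinuousOn.intervalIntegrable
      rw [Set.uIcc_of_le ht]
      exact hcx.mono (fun s hs => hTp.le.trans hs.1)
  rw [intervalIntegral.integral_const_mul] at h1
  refine h1.trans (mul_le_mul_of_nonneg_left ?_ (by linarith))
  rw [← intervalIntegral.integral_add_adjacent_intervals (hint T0 hT0 T hTp)
    (hint T hTp t (by linarith))]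
  have : 0 ≤ ∫ s in T0..T, φ (γ s) :=
    intervalIntegral.integral_nonneg hT
      (fun s hs => (hφ_pos _ (hγ_pos s (lt_of_lt_of_le hT0 hs.1)).le).le)
  linarith


/-- Under (A1), (A2)+(A4), (A±), and (F2) (`γ₊, γ₋` continuous, increasing,
tending to `∞`, with `limsup |H(t)|/γ₊(t) = 0` and `limsup |H(t)|/γ₋(t) = ∞`): if
`γ₊(t)/(M ∫₀ᵗ f(γ₊(s)) ds) → ∞` and `γ₋(t)/(M ∫₀ᵗ f(γ₋(s)) ds) → ∞`, then
`|x(t)|/γ₊(t) → 0` and `limsup |x(t)|/γ₋(t) = ∞`. -/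
theorem stmt11 (μ : Measure ℝ) (M : ℝ) (hM : 0 < M)
    (hμ : μ Set.univ = ENNReal.ofReal M) (hμ0 : μ (Set.Iio 0) = 0)
    (f H x φ φd γp γm : ℝ → ℝ)
    (hf_cont : Continuous f)
    (hH_cont : ContinuousOn H (Set.Ici 0))
    (hx_cont : ContinuousOn x (Set.Ici 0))
    (heq : ∀ t ≥ (0:ℝ),
      x t = x 0 + (∫ s in (0:ℝ)..t, (μ (Set.Icc 0 (t - s))).toReal * f (x s)) + H t)
    (hφ_deriv : ∀ y ≥ (0:ℝ), HasDerivAt φ (φd y) y)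
    (hφd_cont : ContinuousOn φd (Set.Ici 0))
    (hφ_pos : ∀ y ≥ (0:ℝ), 0 < φ y)
    (hφ_inf : Tendsto φ atTop atTop)
    (hφd_pos : ∀ y ≥ (0:ℝ), 0 < φd y)
    (hφd_anti : AntitoneOn φd (Set.Ici 0))
    (hφd_zero : Tendsto φd atTop (nhds 0))
    (hfφ : Tendsto (fun y => |f y| / φ |y|) (Filter.cocompact ℝ) (nhds 1))
    (hγp_cont : ContinuousOn γp (Set.Ioi 0)) (hγp_pos : ∀ t > (0:ℝ), 0 < γp t)
    (hγp_mono : StrictMonoOn γp (Set.Ioi 0)) (hγp_inf : Tendsto γp atTop atTop)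
    (hγm_cont : ContinuousOn γm (Set.Ioi 0)) (hγm_pos : ∀ t > (0:ℝ), 0 < γm t)
    (hγm_mono : StrictMonoOn γm (Set.Ioi 0)) (hγm_inf : Tendsto γm atTop atTop)
    (hHγp : Filter.limsup (fun t => ((|H t| / γp t : ℝ) : EReal)) atTop = 0)
    (hHγm : Filter.limsup (fun t => ((|H t| / γm t : ℝ) : EReal)) atTop = ⊤)
    (hLγp : Tendsto (fun t => γp t / (M * ∫ s in (0:ℝ)..t, f (γp s))) atTop atTop)
    (hLγm : Tendsto (fun t => γm t / (M * ∫ s in (0:ℝ)..t, f (γm s))) atTop atTop) :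
    Tendsto (fun t => |x t| / γp t) atTop (nhds 0) ∧
    Filter.limsup (fun t => ((|x t| / γm t : ℝ) : EReal)) atTop = ⊤ := by

  obtain ⟨hc, hmono, hK⟩ := aux_phi hφ_deriv hφ_pos hφd_pos hφd_anti
  obtain ⟨C, hC, hfC⟩ := aux_bound hf_cont hc hφ_pos hfφ
  constructor
  · obtain ⟨T0, hT0, hlim⟩ := aux_gamma hM hf_cont hc hmono hφ_pos hfφ hγp_cont hγp_pos hγp_inf hLγp
    have hH : ∀ ε > (0:ℝ), ∀ᶠ t in atTop, |H t| / γp t < ε := by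
      intro ε hε
      have : Filter.limsup (fun t => ((|H t| / γp t : ℝ) : EReal)) atTop < (ε : EReal) := by
        rw [hHγp]; exact_mod_cast hε
      filter_upwards [Filter.eventually_lt_of_limsup_lt this] with t ht
      exact_mod_cast ht
    have hMC : 0 < M * C := by positivity
    have hlim2 : Tendsto (fun t => M * C * ((∫ s in T0..t, φ (γp s)) / γp t)) atTop (nhds 0) := by
      simpa using hlim.const_mul (M * C)
    have hq : ∀ᶠ t in atTop, M * C * ((∫ s in T0..t, φ (γp s)) / γp t) < 1/4 :=
      hlim2.eventually (gt_mem_nhds (by norm_num))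
    obtain ⟨T1, hT1⟩ := eventually_atTop.1 (hq.and (hH 1 one_pos))
    set T := max T1 T0 with hTdef
    have hTT0 : T0 ≤ T := le_max_right _ _
    have hTp : 0 < T := lt_of_lt_of_le hT0 hTT0
    obtain ⟨A, hA, hvol⟩ := aux_vol hM hμ hx_cont heq hc hφ_pos hC hfC T hTp.le
    have hγT := hγp_pos T hTp
    have htri : ∀ t, |x t| ≤ |x t - H t| + |H t| := by
      intro t
      have := abs_add_le (x t - H t) (H t)
      simpa using this
    -- boundedness of the ratio
    obtain ⟨K, hK1, hbd⟩ : ∃ K ≥ (1:ℝ), ∀ t ≥ T, |x t| ≤ K * γp t := by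
      refine ⟨max 1 (4/3 * (A / γp T + 1)), le_max_left _ _, fun t ht => ?_⟩
      have hgp : ∀ s ∈ Set.Icc T t, 0 < γp s := fun s hs => hγp_pos s (lt_of_lt_of_le hTp hs.1)
      have hcont : ContinuousOn (fun s => |x s| / γp s) (Set.Icc T t) := by
        apply ContinuousOn.div
        · exact hx_cont.abs.mono (fun s hs => hTp.le.trans hs.1)
        · exact hγp_cont.mono (fun s hs => lt_of_lt_of_le hTp hs.1)
        · exact fun s hs => (hgp s hs).ne'
      obtain ⟨u, hu, hmax⟩ := isCompact_Icc.exists_isMaxOn ⟨t, ht, le_rfl⟩ hcont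
      set S := |x u| / γp u with hS
      have hle : ∀ s ∈ Set.Icc T t, |x s| ≤ S * γp s := by
        intro s hs
        rw [← div_le_iff₀ (hgp s hs)]
        exact hmax hs
      have hSle : S ≤ max 1 (4/3 * (A / γp T + 1)) := by
        rcases le_total S 1 with h | h
        · exact le_max_of_le_left h
        apply le_max_of_le_right
        have h1 := aux_cmp hc hmono hφ_pos hK hx_cont hγp_cont hγp_pos hT0 hTT0 hu.1 h
          (fun s hs => hle s ⟨hs.1, hs.2.trans hu.2⟩)
        have h2 := hvol u hu.1
        have h3 := htri u
        have hgu := hgp u hu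
        obtain ⟨h4, h5⟩ := hT1 u ((le_max_left _ _).trans hu.1)
        rw [div_lt_iff₀ hgu] at h5
        rw [← mul_div_assoc, div_lt_iff₀ hgu] at h4
        have h6 : |x u| = S * γp u := by rw [hS]; field_simp
        have h7 : A ≤ A / γp T * γp u := by
          rw [div_mul_eq_mul_div, le_div_iff₀ hγT]
          exact mul_le_mul_of_nonneg_left (hγp_mono.monotoneOn hTp (lt_of_lt_of_le hTp hu.1) hu.1) hA
        have h8 := mul_le_mul_of_nonneg_left h1 hMC.le
        have h9 : S * (M * C * ∫ s in T0..u, φ (γp s)) ≤ S * (1/4 * γp u) :=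
          mul_le_mul_of_nonneg_left h4.le (by linarith)
        have h10 : S * γp u ≤ (A / γp T + S / 4 + 1) * γp u := by
          rw [← h6]; nlinarith
        have := le_of_mul_le_mul_right h10 hgu
        linarith
      exact (hle t ⟨ht, le_rfl⟩).trans
        (mul_le_mul_of_nonneg_right hSle (hgp t ⟨ht, le_rfl⟩).le)
    have hHt : Tendsto (fun t => |H t| / γp t) atTop (nhds 0) := by
      rw [Metric.tendsto_nhds]
      intro ε hε
      filter_upwards [hH ε hε, eventually_gt_atTop 0] with t ht ht0
      rw [Real.dist_eq, sub_zero, abs_of_nonneg (div_nonneg (abs_nonneg _) (hγp_pos t ht0).le)]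
      exact ht
    have hU := ((hγp_inf.const_div_atTop A).add (hlim2.const_mul K)).add hHt
    simp only [mul_zero, add_zero] at hU
    refine tendsto_of_tendsto_of_tendsto_of_le_of_le' tendsto_const_nhds hU ?_ ?_
    · filter_upwards [eventually_gt_atTop 0] with t ht0
      exact div_nonneg (abs_nonneg _) (hγp_pos t ht0).le
    · filter_upwards [eventually_ge_atTop T] with t ht
      have hg := hγp_pos t (lt_of_lt_of_le hTp ht)
      have h1 := aux_cmp hc hmono hφ_pos hK hx_cont hγp_cont hγp_pos hT0 hTT0 ht hK1
          (fun s hs => hbd s hs.1)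
      have h8 := mul_le_mul_of_nonneg_left h1 hMC.le
      have h2 := hvol t ht
      have h3 := htri t
      rw [div_le_iff₀ hg]
      have : (A / γp t + K * (M * C * ((∫ s in T0..t, φ (γp s)) / γp t)) + |H t| / γp t) * γp t
          = A + M * C * (K * ∫ s in T0..t, φ (γp s)) + |H t| := by
        field_simp
      rw [this]
      linarith
  · by_contra hcon
    obtain ⟨T0, hT0, hlim⟩ := aux_gamma hM hf_cont hc hmono hφ_pos hfφ hγm_cont hγm_pos hγm_inf hLγm
    obtain ⟨K0, hK0, -⟩ := EReal.lt_iff_exists_real_btwn.1 (lt_top_iff_ne_top.2 hcon)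
    have hMC : 0 < M * C := by positivity
    have hq : ∀ᶠ t in atTop, (∫ s in T0..t, φ (γm s)) / γm t < 1 :=
      hlim.eventually (gt_mem_nhds (by norm_num))
    obtain ⟨T1, hT1⟩ := eventually_atTop.1 ((Filter.eventually_lt_of_limsup_lt hK0).and hq)
    set T := max T1 T0 with hTdef
    have hTT0 : T0 ≤ T := le_max_right _ _
    have hTp : 0 < T := lt_of_lt_of_le hT0 hTT0
    set K := max K0 1 with hKdef
    have hK1 : 1 ≤ K := le_max_right _ _
    have hbd : ∀ t ≥ T, |x t| ≤ K * γm t := by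
      intro t ht
      have h1 := (hT1 t ((le_max_left _ _).trans ht)).1
      have h2 : |x t| / γm t < K0 := by exact_mod_cast h1
      rw [← div_le_iff₀ (hγm_pos t (lt_of_lt_of_le hTp ht))]
      exact h2.le.trans (le_max_left _ _)
    obtain ⟨A, hA, hvol⟩ := aux_vol hM hμ hx_cont heq hc hφ_pos hC hfC T hTp.le
    have hfin : ∀ᶠ t in atTop, ((|H t| / γm t : ℝ) : EReal) ≤ ((K + A + M * C * K : ℝ) : EReal) := by
      filter_upwards [eventually_ge_atTop T, hγm_inf.eventually_ge_atTop 1] with t ht hg1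
      rw [EReal.coe_le_coe_iff]
      have hg := hγm_pos t (lt_of_lt_of_le hTp ht)
      rw [div_le_iff₀ hg]
      have h1 := aux_cmp hc hmono hφ_pos hK hx_cont hγm_cont hγm_pos hT0 hTT0 ht hK1
          (fun s hs => hbd s hs.1)
      have h2 := hvol t ht
      have h3 : |H t| ≤ |x t| + |x t - H t| := by
        have := abs_sub (x t) (x t - H t)
        simpa using this
      have h4 := hbd t ht
      have h5 := (hT1 t ((le_max_left _ _).trans ht)).2
      rw [div_lt_iff₀ hg, one_mul] at h5
      have h6 : M * C * ∫ s in T..t, φ |x s| ≤ M * C * (K * γm t) :=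
        mul_le_mul_of_nonneg_left
          (h1.trans (mul_le_mul_of_nonneg_left h5.le (by linarith))) hMC.le
      nlinarith
    have := Filter.limsup_le_of_le (by isBoundedDefault) hfin
    rw [hHγm] at this
    exact absurd this (not_le.2 (EReal.coe_lt_top _))
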